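/- arXiv:1010.1900 — 3 statements merged into one kernel-verified Lean document; each statement's English description precedes it below -/
import Mathlib

section
/- Let m ≥ 1 be an integer, let b_1, …, b_m be real numbers with b_j ≥ 2, and let a_1, …, a_m be real numbers with a_j > 0. Then there exist strictly positive real numbers t, x_1, …, x_m satisfying x_{j−1} − b_j·x_j + x_{j+1} + a_j·t = 0 for all j = 1,…,m (with the convention x_0 = x_{m+1} = 0). -/
/-- Solving the chain with `t = 1`, left boundary value `0` and right boundary value `c ≥ 0`:
a solution positive on the interior exists, and its last interior value is an affine function
`p * c + q` of `c` with `0 ≤ p < 1` and `0 ≤ q`. -/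
theorem exists_pos_chain_solution (b a : ℕ → ℝ) (m : ℕ)
    (hb : ∀ j, 1 ≤ j → j ≤ m → 2 ≤ b j)
    (ha : ∀ j, 1 ≤ j → j ≤ m → 0 < a j) :
    ∃ p q : ℝ, 0 ≤ p ∧ p < 1 ∧ 0 ≤ q ∧ ∀ c : ℝ, 0 ≤ c → ∃ x : ℕ → ℝ,
      x 0 = 0 ∧ x (m + 1) = c ∧ x m = p * c + q ∧ (∀ j, 1 ≤ j → j ≤ m → 0 < x j) ∧
      ∀ j, 1 ≤ j → j ≤ m → x (j - 1) - b j * x j + x (j + 1) + a j = 0 := by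
  induction m with
  | zero =>
    refine ⟨0, 0, le_rfl, one_pos, le_rfl, fun c _ => ⟨fun j => if j = 0 then 0 else c, ?_⟩⟩
    refine ⟨by simp, by simp, by simp, ?_, ?_⟩ <;> intro j h1 h2 <;> omega
  | succ m ih =>
    obtain ⟨p, q, hp0, hp1, hq, h⟩ :=
      ih (fun j h1 h2 => hb j h1 (by omega)) (fun j h1 h2 => ha j h1 (by omega))
    have hbm := hb (m + 1) (by omega) le_rfl
    have ham := ha (m + 1) (by omega) le_rfl
    have hd : 0 < b (m + 1) - p := by linarith
    refine ⟨1 / (b (m + 1) - p), (a (m + 1) + q) / (b (m + 1) - p), by positivity, ?_,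
      by positivity, fun c hc => ?_⟩
    · rw [div_lt_one hd]
      linarith
    have hy : 0 < (c + a (m + 1) + q) / (b (m + 1) - p) := by positivity
    have hyd : (c + a (m + 1) + q) / (b (m + 1) - p) * (b (m + 1) - p) = c + a (m + 1) + q :=
      div_mul_cancel₀ _ hd.ne'
    have hlast : (c + a (m + 1) + q) / (b (m + 1) - p) =
        1 / (b (m + 1) - p) * c + (a (m + 1) + q) / (b (m + 1) - p) := by ring
    generalize (c + a (m + 1) + q) / (b (m + 1) - p) = y at hy hyd hlast
    obtain ⟨x, hx0, hxy, hxm, hpos, heq⟩ := h y hy.le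
    have hlow : ∀ j, j ≤ m + 1 → (if j ≤ m + 1 then x j else c) = x j := fun j hj => if_pos hj
    refine ⟨fun j => if j ≤ m + 1 then x j else c, by simp [hx0], by simp, ?_, ?_, ?_⟩
    · simpa [hxy] using hlast
    · intro j h1 h2
      simp only [hlow j h2]
      rcases h2.eq_or_lt with rfl | hlt
      · rwa [hxy]
      · exact hpos j h1 (by omega)
    · intro j h1 h2
      simp only [hlow j h2, hlow (j - 1) (by omega)]
      rcases h2.eq_or_lt with rfl | hlt
      · rw [if_neg (by omega), Nat.add_sub_cancel, hxy, hxm]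
        linarith
      · rw [hlow (j + 1) (by omega)]
        exact heq j h1 (by omega)

/-- There exist strictly positive real numbers `t, x_1, …, x_m` satisfying
`x_{j-1} - b_j x_j + x_{j+1} + a_j t = 0` for `j = 1, …, m`, with the
convention `x_0 = x_{m+1} = 0`. -/
theorem stmt_4 (m : ℕ) (hm : 1 ≤ m) (b a : ℕ → ℝ)
    (hb : ∀ j, 1 ≤ j → j ≤ m → 2 ≤ b j)
    (ha : ∀ j, 1 ≤ j → j ≤ m → 0 < a j) :
    ∃ (t : ℝ) (x : ℕ → ℝ),
      0 < t ∧ (∀ j, 1 ≤ j → j ≤ m → 0 < x j) ∧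
      x 0 = 0 ∧ x (m + 1) = 0 ∧
      (∀ j, 1 ≤ j → j ≤ m → x (j - 1) - b j * x j + x (j + 1) + a j * t = 0) := by
  obtain ⟨_, _, _, _, _, h⟩ := exists_pos_chain_solution b a m hb ha
  obtain ⟨x, hx0, hxm, _, hpos, heq⟩ := h 0 le_rfl
  exact ⟨1, x, one_pos, hpos, hx0, hxm, by simpa only [mul_one] using heq⟩
end

section
/- Let m ≥ 1 be an integer, let b_1, …, b_m be integers with b_j ≥ 2, and let a_1, …, a_m be integers with a_j ≥ 1. Then there exist positive integers t, x_1, …, x_m (all ≥ 1) satisfying x_{j−1} − b_j·x_j + x_{j+1} + a_j·t = 0 for all j = 1,…,m (with the convention x_0 = x_{m+1} = 0). -/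
/-- The solution of `x (j + 2) = b (j + 1) * x (j + 1) - x j - a (j + 1)` with `x 0 = 0` and
`x 1 = c`. -/
def chainSeq (b a : ℕ → ℤ) (c : ℤ) : ℕ → ℤ
  | 0 => 0
  | 1 => c
  | j + 2 => b (j + 1) * chainSeq b a c (j + 1) - chainSeq b a c j - a (j + 1)

theorem chainSeq_homogeneous_lt_succ {m : ℕ} {b : ℕ → ℤ}
    (hb : ∀ j, 1 ≤ j → j ≤ m → 2 ≤ b j) {j : ℕ} (hj : j ≤ m) :
    0 ≤ chainSeq b 0 1 j ∧ chainSeq b 0 1 j < chainSeq b 0 1 (j + 1) := by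
  induction j with
  | zero => simp [chainSeq]
  | succ k ih =>
    obtain ⟨h0, h1⟩ := ih (by omega)
    have hbk := hb (k + 1) (by omega) hj
    refine ⟨by omega, ?_⟩
    simp only [chainSeq, Pi.zero_apply]
    nlinarith

/-- The discrete Wronskian of a solution `x` of the inhomogeneous recurrence and the homogeneous
solution is positive. -/
theorem chainSeq_wronskian_pos {m : ℕ} {b a x : ℕ → ℤ} {t : ℤ}
    (hb : ∀ j, 1 ≤ j → j ≤ m → 2 ≤ b j) (ha : ∀ j, 1 ≤ j → j ≤ m → 1 ≤ a j)
    (ht : 1 ≤ t) (hx0 : x 0 = 0)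
    (hx : ∀ j, x (j + 2) = b (j + 1) * x (j + 1) - x j - a (j + 1) * t) {j : ℕ} (hj : j < m) :
    0 < x (j + 1) * chainSeq b 0 1 (j + 2) - x (j + 2) * chainSeq b 0 1 (j + 1) := by
  have hstep : ∀ k, x (k + 1) * chainSeq b 0 1 (k + 2) - x (k + 2) * chainSeq b 0 1 (k + 1) =
      x k * chainSeq b 0 1 (k + 1) - x (k + 1) * chainSeq b 0 1 k
        + a (k + 1) * t * chainSeq b 0 1 (k + 1) := by
    intro k
    rw [hx k, chainSeq, Pi.zero_apply]
    ring
  have hpos : ∀ k, k < m → 0 < a (k + 1) * t * chainSeq b 0 1 (k + 1) := by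
    intro k hk
    have hak := ha (k + 1) (by omega) hk
    obtain ⟨h0, h1⟩ := chainSeq_homogeneous_lt_succ hb hk.le
    have hu : 0 < chainSeq b 0 1 (k + 1) := by omega
    positivity
  induction j with
  | zero =>
    rw [hstep, hx0]
    simpa [chainSeq] using hpos 0 hj
  | succ k ih =>
    rw [hstep]
    exact add_pos (ih (by omega)) (hpos _ hj)


/-- There exist positive integers `t, x_1, …, x_m` (all `≥ 1`) satisfying
`x_{j-1} - b_j x_j + x_{j+1} + a_j t = 0` for `j = 1, …, m`, with the
convention `x_0 = x_{m+1} = 0`. -/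
theorem stmt_5 (m : ℕ) (hm : 1 ≤ m) (b a : ℕ → ℤ)
    (hb : ∀ j, 1 ≤ j → j ≤ m → 2 ≤ b j)
    (ha : ∀ j, 1 ≤ j → j ≤ m → 1 ≤ a j) :
    ∃ (t : ℤ) (x : ℕ → ℤ),
      1 ≤ t ∧ (∀ j, 1 ≤ j → j ≤ m → 1 ≤ x j) ∧
      x 0 = 0 ∧ x (m + 1) = 0 ∧
      (∀ j, 1 ≤ j → j ≤ m → x (j - 1) - b j * x j + x (j + 1) + a j * t = 0) := by
  set u := chainSeq b 0 1 with hu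
  set p := chainSeq b a 0 with hp
  have hu_pos : ∀ j, j ≤ m → 0 < u (j + 1) := fun j hj =>
    (chainSeq_homogeneous_lt_succ hb hj).1.trans_lt (chainSeq_homogeneous_lt_succ hb hj).2
  have ht : 1 ≤ u (m + 1) := hu_pos m le_rfl
  let x : ℕ → ℤ := fun j => u (m + 1) * p j - p (m + 1) * u j
  have hx0 : x 0 = 0 := by simp [x, hu, hp, chainSeq]
  have hxm : x (m + 1) = 0 := by simp only [x]; ring
  have hx : ∀ j, x (j + 2) = b (j + 1) * x (j + 1) - x j - a (j + 1) * u (m + 1) := by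
    intro j
    have h1 : u (j + 2) = b (j + 1) * u (j + 1) - u j := by simp [hu, chainSeq]
    have h2 : p (j + 2) = b (j + 1) * p (j + 1) - p j - a (j + 1) := by simp [hp, chainSeq]
    simp only [x, h1, h2]
    ring
  have hx_nonneg_pos : ∀ j, j < m → 0 ≤ x (j + 2) → 0 < x (j + 1) := by
    intro j hj h
    have hw := chainSeq_wronskian_pos hb ha ht hx0 hx hj
    rw [← hu] at hw
    have h1 := mul_nonneg h (hu_pos j hj.le).le
    exact pos_of_mul_pos_left (by linarith) (hu_pos (j + 1) hj).le
  have hx_nonneg : ∀ j, j ≤ m → 0 ≤ x (j + 1) := by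
    intro j hj
    induction hj using Nat.decreasingInduction with
    | self => exact hxm.ge
    | of_succ k hk ih => exact (hx_nonneg_pos k hk ih).le
  refine ⟨u (m + 1), x, ht, ?_, hx0, hxm, ?_⟩
  · rintro (_ | j) h1 hj
    · omega
    · exact hx_nonneg_pos j hj (hx_nonneg (j + 1) hj)
  · rintro (_ | j) h1 hj
    · omega
    · rw [Nat.add_sub_cancel, hx j]
      ring
end

section
/- Let m ≥ 1 be an integer, let b_1, …, b_m be integers with b_j ≥ 2, and let a_1, …, a_m be integers with a_j ≥ 1. If (t, x_1, …, x_m) and (t′, x′_1, …, x′_m) are two tuples of positive integers each satisfying x_{j−1} − b_j·x_j + x_{j+1} + a_j·t = 0 for all j = 1,…,m (with the convention x_0 = x_{m+1} = 0, and similarly for the primed tuple), then the two tuples are proportional: t′·x_j = t·x′_j for all j = 1,…,m. -/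
/-- A solution of `y_{j-1} - b_j y_j + y_{j+1} = 0` with all `b_j ≥ 2`, `y_0 = 0` and `0 ≤ y_1`
is nonnegative and monotone. -/
lemma chain_nonneg_and_le_succ {m : ℕ} {b y : ℕ → ℤ}
    (hb : ∀ j, 1 ≤ j → j ≤ m → 2 ≤ b j) (h0 : y 0 = 0)
    (heq : ∀ j, 1 ≤ j → j ≤ m → y (j - 1) - b j * y j + y (j + 1) = 0) (h1 : 0 ≤ y 1)
    (j : ℕ) (hj : j ≤ m) : 0 ≤ y j ∧ y j ≤ y (j + 1) := by
  induction j with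
  | zero => simpa [h0] using h1
  | succ k ih =>
    obtain ⟨hk, hle⟩ := ih (by omega)
    have hrec := heq (k + 1) (by omega) hj
    rw [Nat.add_sub_cancel] at hrec
    have hnn : 0 ≤ y (k + 1) := hk.trans hle
    exact ⟨hnn, by linarith [mul_le_mul_of_nonneg_right (hb (k + 1) (by omega) hj) hnn]⟩

/-- A solution of `y_{j-1} - b_j y_j + y_{j+1} = 0` with all `b_j ≥ 2` and
`y_0 = y_{m+1} = 0` vanishes. -/
lemma chain_eq_zero {m : ℕ} {b y : ℕ → ℤ}
    (hb : ∀ j, 1 ≤ j → j ≤ m → 2 ≤ b j) (h0 : y 0 = 0) (hm : y (m + 1) = 0)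
    (heq : ∀ j, 1 ≤ j → j ≤ m → y (j - 1) - b j * y j + y (j + 1) = 0)
    (j : ℕ) (hj : j ≤ m) : y j = 0 := by
  wlog h1 : 0 ≤ y 1 generalizing y
  · refine neg_eq_zero.mp (this (y := fun i => -y i) (by simp [h0]) (by simp [hm]) ?_ ?_)
    · intro i hi him
      linarith [heq i hi him]
    · exact neg_nonneg.mpr (not_le.mp h1).le
  have hmono := chain_nonneg_and_le_succ hb h0 heq h1
  have hnonpos : y j ≤ 0 := by
    induction hj using Nat.decreasingInduction with
    | self => exact (hmono m le_rfl).2.trans_eq hm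
    | of_succ k hk ih => exact (hmono k hk.le).2.trans ih
  exact hnonpos.antisymm (hmono j hj).1

/-- Any two positive-integer solutions `(t, x₁, …, x_m)` and
`(t', x'₁, …, x'_m)` of the system `x_{j-1} - b_j x_j + x_{j+1} + a_j t = 0`
(`j = 1, …, m`, with the convention `x_0 = x_{m+1} = 0`) are proportional:
`t' · x_j = t · x'_j` for all `j`. -/
theorem stmt_10 (m : ℕ) (hm : 1 ≤ m) (b a : ℕ → ℤ)
    (hb : ∀ j, 1 ≤ j → j ≤ m → 2 ≤ b j)
    (ha : ∀ j, 1 ≤ j → j ≤ m → 1 ≤ a j)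
    (t t' : ℤ) (x x' : ℕ → ℤ)
    (ht : 1 ≤ t) (ht' : 1 ≤ t')
    (hx : ∀ j, 1 ≤ j → j ≤ m → 1 ≤ x j)
    (hx' : ∀ j, 1 ≤ j → j ≤ m → 1 ≤ x' j)
    (hx0 : x 0 = 0) (hxm : x (m + 1) = 0)
    (hx'0 : x' 0 = 0) (hx'm : x' (m + 1) = 0)
    (heq : ∀ j, 1 ≤ j → j ≤ m → x (j - 1) - b j * x j + x (j + 1) + a j * t = 0)
    (heq' : ∀ j, 1 ≤ j → j ≤ m → x' (j - 1) - b j * x' j + x' (j + 1) + a j * t' = 0) :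
    ∀ j, 1 ≤ j → j ≤ m → t' * x j = t * x' j := by
  intro j _ hjm
  refine sub_eq_zero.mp (chain_eq_zero (y := fun i => t' * x i - t * x' i) hb
    (by simp [hx0, hx'0]) (by simp [hxm, hx'm]) ?_ j hjm)
  intro i hi him
  linear_combination t' * heq i hi him - t * heq' i hi him
end
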